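/- arXiv:1801.05556 — 7 statements merged into one kernel-verified Lean document; each statement's English description precedes it below -/
import Mathlib

section
/- Let c₁, c₂, c₃ be positive integers and let (u_j)_{j≥0} be the integer sequence defined by u₀ = 0, u₁ = 0, u₂ = 1, and u_j = c₁·u_{j−1} − c₂·u_{j−2} + c₃·u_{j−3} for j > 2. Suppose there exists an integer m > 2 such that u_m = 0, u_{m+1} = 0, and u_j > 0 for all j with 2 ≤ j ≤ m − 1. Then m = 4 or m = 6. -/
section CubicRecurrence

variable {c1 c2 c3 : ℤ} {u : ℕ → ℤ}

/-- Powers of a root of the characteristic polynomial, reduced modulo that polynomial. -/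
theorem pow_succ_eq_of_cubic_root {R : Type*} [CommRing R]
    (h0 : u 0 = 0) (h1 : u 1 = 0) (h2 : u 2 = 1)
    (hrec : ∀ j : ℕ, u (j + 3) = c1 * u (j + 2) - c2 * u (j + 1) + c3 * u j)
    {x : R} (hx : x ^ 3 - c1 * x ^ 2 + c2 * x - c3 = 0) (n : ℕ) :
    x ^ (n + 1) = u (n + 1) * x ^ 2 + (u (n + 2) - c1 * u (n + 1)) * x + c3 * u n := by
  induction n with
  | zero => simp [h0, h1, h2]
  | succ n ih =>
    have h := congrArg (Int.cast : ℤ → R) (hrec n)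
    push_cast at h
    rw [pow_succ, ih, show n + 1 + 2 = n + 3 from rfl, show n + 1 + 1 = n + 2 from rfl, h]
    linear_combination (u (n + 1) : R) * hx

/-- The recurrence whose characteristic polynomial is `(t - r) ^ 3`. -/
theorem two_mul_eq_of_triple_root {r : ℤ} (h0 : u 0 = 0) (h1 : u 1 = 0) (h2 : u 2 = 1)
    (hrec : ∀ j : ℕ, u (j + 3) = 3 * r * u (j + 2) - 3 * r * r * u (j + 1) + r ^ 3 * u j)
    (n : ℕ) : 2 * r ^ 2 * u n = n * (n - 1) * r ^ n := by
  induction n using Nat.strong_induction_on with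
  | _ n ih =>
    match n with
    | 0 => simp [h0]
    | 1 => simp [h1]
    | 2 => rw [h2]; push_cast; ring
    | n + 3 =>
      have e0 := ih n (by omega)
      have e1 := ih (n + 1) (by omega)
      have e2 := ih (n + 2) (by omega)
      rw [hrec]
      push_cast at *
      linear_combination 3 * r * e2 - 3 * r * r * e1 + r ^ 3 * e0

theorem exists_pos_cubic_root (hc3 : 0 < c3) (hc1 : 0 < c1) (hc2 : 0 < c2) :
    ∃ x : ℝ, 0 < x ∧ x ^ 3 - c1 * x ^ 2 + c2 * x - c3 = 0 := by
  have hc1' : (0 : ℝ) < c1 := by exact_mod_cast hc1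
  have hc2' : (0 : ℝ) < c2 := by exact_mod_cast hc2
  have hc3' : (0 : ℝ) < c3 := by exact_mod_cast hc3
  have hb : (0 : ℝ) ≤ c1 + c3 + 1 := by positivity
  obtain ⟨x, hx, hfx⟩ := intermediate_value_Icc
    (f := fun x : ℝ => x ^ 3 - c1 * x ^ 2 + c2 * x - c3) hb (by fun_prop)
    (show (0 : ℝ) ∈ _ by
      constructor
      · simpa using hc3'.le
      · have : (0 : ℝ) ≤ (c1 + c3 + 1) ^ 2 * (c3 + 1) + c2 * (c1 + c3 + 1) - c3 := by
          nlinarith [mul_pos hc1' hc3', mul_pos hc2' hc3', mul_pos hc2' hc1', pow_pos hc3' 3,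
            mul_pos (mul_pos hc1' hc3') hc3', mul_pos (mul_pos hc1' hc1') hc3']
        linarith)
  refine ⟨x, hx.1.lt_of_ne ?_, hfx⟩
  rintro rfl
  simp at hfx
  omega

/-- A cubic with positive alternating coefficients whose complex roots all have the same positive
`m`-th power is `(t - r) (t ^ 2 - k r t + r ^ 2)` for integers `r > 0` and `0 ≤ k ≤ 2`. -/
theorem exists_coeff_eq_of_root_pow_eq (hc1 : 0 < c1) (hc2 : 0 < c2) (hc3 : 0 < c3)
    {m : ℕ} (hm : m ≠ 0) {l : ℤ}
    (hl : ∀ x : ℂ, x ^ 3 - c1 * x ^ 2 + c2 * x - c3 = 0 → x ^ m = l) :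
    ∃ r k : ℤ, 0 < r ∧ 0 ≤ k ∧ k ≤ 2 ∧
      c1 = (k + 1) * r ∧ c2 = (k + 1) * r * r ∧ c3 = r ^ 3 := by
  obtain ⟨p, hp, hfp⟩ := exists_pos_cubic_root hc3 hc1 hc2
  have hfpC : (p : ℂ) ^ 3 - c1 * p ^ 2 + c2 * p - c3 = 0 := by exact_mod_cast hfp
  obtain ⟨w, hw⟩ := IsAlgClosed.exists_pow_nat_eq
    (((c1 : ℂ) - p) ^ 2 - 4 * (c2 - p * (c1 - p))) (n := 2) (by norm_num)
  obtain ⟨b, hb⟩ : ∃ b : ℂ, b = (c1 - p + w) / 2 := ⟨_, rfl⟩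
  obtain ⟨g, hg⟩ : ∃ g : ℂ, g = (c1 - p - w) / 2 := ⟨_, rfl⟩
  have hsum : b + g = c1 - p := by rw [hb, hg]; ring
  have hprod : b * g = c2 - p * (c1 - p) := by
    rw [hb, hg]; linear_combination (-1 / 4 : ℂ) * hw
  have hfac : ∀ x : ℂ, x ^ 3 - c1 * x ^ 2 + c2 * x - c3 = (x - p) * (x - b) * (x - g) := by
    intro x
    linear_combination hfpC + (x - p) * (x * hsum - hprod)
  have hpl := hl p hfpC
  have hbl := hl b (by rw [hfac]; ring)
  have hgl := hl g (by rw [hfac]; ring)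
  have hnorm : ∀ x : ℂ, x ^ m = l → ‖x‖ = p := by
    intro x hx
    have h := congrArg norm (hx.trans hpl.symm)
    rw [norm_pow, norm_pow, Complex.norm_of_nonneg hp.le] at h
    exact (pow_left_inj₀ (norm_nonneg x) hp.le hm).1 h
  have hc1' : (0 : ℝ) < c1 := by exact_mod_cast hc1
  have hc3' : (0 : ℝ) < c3 := by exact_mod_cast hc3
  have hq : p * (c2 - p * (c1 - p)) = c3 := by linear_combination hfp
  have hqpos : 0 < c2 - p * (c1 - p) := by
    by_contra! h
    nlinarith
  have hqp : c2 - p * (c1 - p) = p * p := by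
    have h := congrArg norm hprod
    rw [norm_mul, hnorm b hbl, hnorm g hgl,
      show (c2 : ℂ) - p * (c1 - p) = ((c2 - p * (c1 - p) : ℝ) : ℂ) by push_cast; rfl,
      Complex.norm_of_nonneg hqpos.le] at h
    exact h.symm
  have hc2p : (c2 : ℝ) = c1 * p := by linear_combination hqp
  have hc3p : (c3 : ℝ) = p ^ 3 := by rw [← hq, hqp]; ring
  have hcube : c2 ^ 3 = c1 ^ 3 * c3 := by
    have : (c2 : ℝ) ^ 3 = c1 ^ 3 * c3 := by rw [hc2p, hc3p]; ring
    exact_mod_cast this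
  obtain ⟨r, hr⟩ : c1 ∣ c2 := (Int.pow_dvd_pow_iff (by norm_num : 3 ≠ 0)).1 ⟨c3, hcube⟩
  have hpr : p = r := by
    have : (c1 : ℝ) * r = c1 * p := by rw [← hc2p, hr]; push_cast; rfl
    exact (mul_left_cancel₀ hc1'.ne' this).symm
  subst hpr
  have hrpos : 0 < r := by exact_mod_cast hp
  have hr0 : (r : ℂ) ≠ 0 := by exact_mod_cast hrpos.ne'
  have hintegral : ∀ x : ℂ, x ^ m = l → IsIntegral ℤ (x / r) := by
    intro x hx
    refine IsIntegral.of_pow (Nat.pos_of_ne_zero hm) ?_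
    have : (x / r) ^ m = 1 := by
      push_cast at hpl
      rw [div_pow, hx, hpl]
      refine div_self ?_
      rw [← hpl]
      exact pow_ne_zero _ hr0
    rw [this]
    exact isIntegral_one
  have hI := (hintegral b hbl).add (hintegral g hgl)
  rw [← add_div, hsum, show ((c1 : ℂ) - ((r : ℝ) : ℂ)) / r =
    algebraMap ℚ ℂ ((c1 - r) / r) by simp,
    isIntegral_algebraMap_iff (algebraMap ℚ ℂ).injective] at hI
  obtain ⟨k, hk⟩ := IsIntegrallyClosed.isIntegral_iff.1 hI
  have hk' : c1 = (k + 1) * r := by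
    have hr' : (r : ℚ) ≠ 0 := by exact_mod_cast hrpos.ne'
    simp only [eq_intCast] at hk
    rw [eq_div_iff hr'] at hk
    have : (c1 : ℚ) = (k + 1) * r := by linear_combination -hk
    exact_mod_cast this
  have hk2 : k * r ≤ 2 * r := by
    have h := norm_add_le b g
    rw [hnorm b hbl, hnorm g hgl, hsum, hk',
      show (((k + 1) * r : ℤ) : ℂ) - ((r : ℝ) : ℂ) = ((k * r : ℝ) : ℂ) by push_cast; ring,
      Complex.norm_real] at h
    have h' := (le_abs_self _).trans h
    have : (k * r : ℝ) ≤ 2 * r := by linarith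
    exact_mod_cast this
  refine ⟨r, k, hrpos, ?_, le_of_mul_le_mul_right hk2 hrpos, hk', by rw [hr, hk'], ?_⟩
  · have := pos_of_mul_pos_left (hk' ▸ hc1) hrpos.le
    omega
  · exact_mod_cast hc3p

end CubicRecurrence

/-- If the order-three recurrence sequence with positive integer
coefficients `c₁, c₂, c₃` and initial conditions `u₀ = u₁ = 0`, `u₂ = 1` has two
consecutive zeros `u_m = u_{m+1} = 0` for some `m > 2`, with `u_j > 0` for
`2 ≤ j ≤ m - 1`, then `m = 4` or `m = 6`. -/
theorem stmt0 (c1 c2 c3 : ℤ) (hc1 : 0 < c1) (hc2 : 0 < c2) (hc3 : 0 < c3)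
    (u : ℕ → ℤ) (h0 : u 0 = 0) (h1 : u 1 = 0) (h2 : u 2 = 1)
    (hrec : ∀ j : ℕ, 2 < j → u j = c1 * u (j - 1) - c2 * u (j - 2) + c3 * u (j - 3))
    (m : ℕ) (hm : 2 < m) (hum : u m = 0) (hum1 : u (m + 1) = 0)
    (hpos : ∀ j : ℕ, 2 ≤ j → j ≤ m - 1 → 0 < u j) :
    m = 4 ∨ m = 6 := by
  have hrec' : ∀ j : ℕ, u (j + 3) = c1 * u (j + 2) - c2 * u (j + 1) + c3 * u j :=
    fun j => hrec (j + 3) (by omega)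
  obtain ⟨r, k, hr, hk0, hk2, e1, e2, e3⟩ :=
    exists_coeff_eq_of_root_pow_eq hc1 hc2 hc3 (m := m) (by omega) (l := c3 * u (m - 1)) (by
      intro x hx
      obtain ⟨n, rfl⟩ : ∃ n, m = n + 1 := ⟨m - 1, by omega⟩
      rw [pow_succ_eq_of_cubic_root h0 h1 h2 hrec' hx n, hum, hum1]
      simp)
  have h3 : u 3 = c1 := by simp [hrec' 0, h0, h1, h2]
  have h4 : u 4 = c1 * c1 - c2 := by rw [hrec' 1, h3, h2, h1]; ring
  have hm3 : m ≠ 3 := by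
    rintro rfl
    omega
  interval_cases k
  · left
    by_contra hm4
    have := hpos 4 (by norm_num) (by omega)
    rw [h4, e1, e2] at this
    simp at this
  · have h5 : u 5 = r ^ 3 := by rw [hrec' 2, h4, h3, h2, e1, e2, e3]; ring
    have h6 : u 6 = 0 := by rw [hrec' 3, h5, h4, h3, e1, e2, e3]; ring
    have hm5 : m ≠ 5 := by
      rintro rfl
      exact (pow_pos hr 3).ne' (h5.symm.trans hum)
    by_contra! hm46
    exact (hpos 6 (by norm_num) (by omega)).ne' h6
  · have h := two_mul_eq_of_triple_root (r := r) h0 h1 h2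
      (fun j => by rw [hrec', e1, e2, e3]; ring) m
    rw [hum, mul_zero] at h
    have hm' : (2 : ℤ) < m := by exact_mod_cast hm
    have : 0 < (m : ℤ) * (m - 1) * r ^ m :=
      mul_pos (mul_pos (by omega) (by omega)) (pow_pos hr m)
    omega
end

section
/- Let c₁, c₂, c₃ be positive integers, let (u_j)_{j≥0} be the integer sequence defined by u₀ = 0, u₁ = 0, u₂ = 1, and u_j = c₁·u_{j−1} − c₂·u_{j−2} + c₃·u_{j−3} for j > 2, and let A be the 3×3 rational companion matrix with rows (c₁, −c₂, c₃), (1, 0, 0), (0, 1, 0). Suppose m > 2 is an integer with u_m = 0, u_{m+1} = 0, and u_j > 0 for 2 ≤ j ≤ m − 1, and set d = c₃·u_{m−1}. Then d > 0 and Aᵐ = d·I₃, where I₃ is the 3×3 identity matrix. -/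
/-- Powers of the companion-type matrix with first row `(a, -b, c)` in terms of the recurrence
sequence with initial values `0, 0, 1`. -/
theorem companion_pow_add_two {R : Type*} [CommRing R] (a b c : R) (v : ℕ → R)
    (h0 : v 0 = 0) (h1 : v 1 = 0) (h2 : v 2 = 1)
    (hrec : ∀ n, v (n + 3) = a * v (n + 2) - b * v (n + 1) + c * v n) (n : ℕ) :
    !![a, -b, c; 1, 0, 0; 0, 1, 0] ^ (n + 2) =
      !![v (n + 4), -b * v (n + 3) + c * v (n + 2), c * v (n + 3);
         v (n + 3), -b * v (n + 2) + c * v (n + 1), c * v (n + 2);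
         v (n + 2), -b * v (n + 1) + c * v n, c * v (n + 1)] := by
  induction n with
  | zero =>
    have h3 := hrec 0
    have h4 := hrec 1
    ext i j
    fin_cases i <;> fin_cases j <;>
      simp [pow_two, Matrix.mul_apply, Fin.sum_univ_three] <;> grind
  | succ n ih =>
    have e3 := hrec n
    have e4 := hrec (n + 1)
    have e5 := hrec (n + 2)
    rw [show n + 1 + 2 = (n + 2) + 1 by ring, pow_succ', ih]
    ext i j
    fin_cases i <;> fin_cases j <;>
      simp [Matrix.mul_apply, Fin.sum_univ_three] <;> grind

/-- With the recurrence sequence `u` as in the two-consecutive-zeros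
lemma and `A` the rational companion-type matrix with rows `(c₁, −c₂, c₃)`,
`(1,0,0)`, `(0,1,0)`, if `u_m = u_{m+1} = 0` with `u_j > 0` for `2 ≤ j ≤ m − 1`
and `d = c₃ u_{m−1}`, then `d > 0` and `Aᵐ = d • I₃`. -/
theorem stmt4 (c1 c2 c3 : ℤ) (hc1 : 0 < c1) (hc2 : 0 < c2) (hc3 : 0 < c3)
    (u : ℕ → ℤ) (h0 : u 0 = 0) (h1 : u 1 = 0) (h2 : u 2 = 1)
    (hrec : ∀ j : ℕ, 2 < j → u j = c1 * u (j - 1) - c2 * u (j - 2) + c3 * u (j - 3))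
    (A : Matrix (Fin 3) (Fin 3) ℚ)
    (hA : A = !![(c1 : ℚ), -(c2 : ℚ), (c3 : ℚ); 1, 0, 0; 0, 1, 0])
    (m : ℕ) (hm : 2 < m) (hum : u m = 0) (hum1 : u (m + 1) = 0)
    (hpos : ∀ j : ℕ, 2 ≤ j → j ≤ m - 1 → 0 < u j)
    (d : ℤ) (hd : d = c3 * u (m - 1)) :
    0 < d ∧ A ^ m = (d : ℚ) • (1 : Matrix (Fin 3) (Fin 3) ℚ) := by
  obtain ⟨k, rfl⟩ : ∃ k, m = k + 2 := ⟨m - 2, by omega⟩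
  have hr : ∀ n, u (n + 3) = c1 * u (n + 2) - c2 * u (n + 1) + c3 * u n :=
    fun n => hrec (n + 3) (by omega)
  rw [show k + 2 - 1 = k + 1 by omega] at hd
  refine ⟨hd ▸ mul_pos hc3 (hpos (k + 1) (by omega) (by omega)), ?_⟩
  have e3 : -(c2 : ℚ) * u (k + 1) + c3 * u k = 0 := by
    have := hr k
    rw [hum, show k + 3 = k + 2 + 1 by ring, hum1] at this
    exact_mod_cast (by linarith : -c2 * u (k + 1) + c3 * u k = 0)
  have e4 : u (k + 4) = d := by
    rw [hr (k + 1), hd, hum, show k + 1 + 2 = k + 2 + 1 by ring, hum1]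
    ring
  have hum1' : u (k + 3) = 0 := hum1
  rw [hA, companion_pow_add_two (c1 : ℚ) c2 c3 (fun n => (u n : ℚ)) (by simp [h0]) (by simp [h1])
    (by simp [h2]) (fun n => by simp [hr n])]
  ext i j
  fin_cases i <;> fin_cases j <;> simp [hum, hum1', e4, hd] <;> linarith
end

section
/- Let c₁, c₂, c₃ be positive integers and let (u_j)_{j≥0} be the integer sequence defined by u₀ = 0, u₁ = 0, u₂ = 1, and u_j = c₁·u_{j−1} − c₂·u_{j−2} + c₃·u_{j−3} for j > 2. Suppose m > 2 is an integer with u_m = 0, u_{m+1} = 0, and u_j > 0 for 2 ≤ j ≤ m − 1, and set d = c₃·u_{m−1}. Then the polynomial t³ − c₁t² + c₂t − c₃ divides the polynomial tᵐ − d in ℚ[t]. -/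
open Polynomial

/-- The remainder of `X ^ n` modulo a monic cubic, in terms of a solution of the associated linear
recurrence with initial values `0, 0, 1`. -/
theorem cubic_dvd_X_pow_sub {R : Type*} [CommRing R] (a b c : R) (v : ℕ → R)
    (h0 : v 0 = 0) (h1 : v 1 = 0) (h2 : v 2 = 1)
    (hrec : ∀ n, v (n + 3) = a * v (n + 2) - b * v (n + 1) + c * v n) (n : ℕ) :
    (X ^ 3 - C a * X ^ 2 + C b * X - C c) ∣
      (X ^ n - (C (v n) * X ^ 2 + C (v (n + 1) - a * v n) * X
        + C (v (n + 2) - a * v (n + 1) + b * v n))) := by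
  induction n with
  | zero => simp [h0, h1, h2]
  | succ n ih =>
    obtain ⟨q, hq⟩ := ih
    refine ⟨X * q + C (v n), ?_⟩
    rw [show n + 1 + 2 = n + 3 from rfl, hrec n]
    simp only [map_add, map_sub, map_mul] at hq ⊢
    linear_combination X * hq

/-- Under the hypotheses of the two-consecutive-zeros lemma, the
characteristic polynomial `t³ − c₁t² + c₂t − c₃` divides `tᵐ − d` in `ℚ[t]`,
where `d = c₃ u_{m−1}`. -/
theorem stmt6 (c1 c2 c3 : ℤ) (hc1 : 0 < c1) (hc2 : 0 < c2) (hc3 : 0 < c3)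
    (u : ℕ → ℤ) (h0 : u 0 = 0) (h1 : u 1 = 0) (h2 : u 2 = 1)
    (hrec : ∀ j : ℕ, 2 < j → u j = c1 * u (j - 1) - c2 * u (j - 2) + c3 * u (j - 3))
    (m : ℕ) (hm : 2 < m) (hum : u m = 0) (hum1 : u (m + 1) = 0)
    (hpos : ∀ j : ℕ, 2 ≤ j → j ≤ m - 1 → 0 < u j) :
    (X ^ 3 - C (c1 : ℚ) * X ^ 2 + C (c2 : ℚ) * X - C (c3 : ℚ)) ∣
      (X ^ m - C ((c3 * u (m - 1) : ℤ) : ℚ)) := by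
  have hdvd := cubic_dvd_X_pow_sub (c1 : ℚ) c2 c3 (fun n => (u n : ℚ)) (by simp [h0]) (by simp [h1])
    (by simp [h2]) (fun n => by exact_mod_cast hrec (n + 3) (by omega)) m
  have hd : u (m + 2) = c3 * u (m - 1) := by
    simpa [hum, hum1] using hrec (m + 2) (by omega)
  simpa [hum, hum1, hd] using hdvd
end

section
/- Let c₁, c₂, c₃ be positive integers and let (u_j)_{j≥0} be the integer sequence defined by u₀ = 0, u₁ = 0, u₂ = 1, and u_j = c₁·u_{j−1} − c₂·u_{j−2} + c₃·u_{j−3} for j > 2. Suppose m > 2 is an integer with u_m = 0, u_{m+1} = 0, and u_j > 0 for 2 ≤ j ≤ m − 1. Then the characteristic polynomial t³ − c₁t² + c₂t − c₃ has three pairwise distinct complex roots (i.e., it is squarefree over ℂ). -/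
open Polynomial

/-- Reduction of the powers of `X` modulo `X³ - aX² + bX - c`: the coefficients of the remainder
are given by the impulse response sequence of the recurrence. -/
theorem dvd_X_pow_succ_sub_impulse {R : Type*} [CommRing R] (a b c : R) (v : ℕ → R)
    (h0 : v 0 = 0) (h1 : v 1 = 0) (h2 : v 2 = 1)
    (hrec : ∀ n, v (n + 3) = a * v (n + 2) - b * v (n + 1) + c * v n) (n : ℕ) :
    (X ^ 3 - C a * X ^ 2 + C b * X - C c) ∣
      X ^ (n + 1) -
        (C (v (n + 1)) * X ^ 2 + C (v (n + 2) - a * v (n + 1)) * X + C (c * v n)) := by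
  induction n with
  | zero => simp [h0, h1, h2]
  | succ n ih =>
    obtain ⟨q, hq⟩ := ih
    refine ⟨X * q + C (v (n + 1)), ?_⟩
    rw [show n + 1 + 2 = n + 3 from rfl, hrec n]
    simp only [C_add, C_sub, C_mul] at hq ⊢
    linear_combination X * hq

/-- Under the hypotheses of the two-consecutive-zeros lemma, the
characteristic polynomial `t³ − c₁t² + c₂t − c₃` has three pairwise distinct
complex roots. -/
theorem stmt7 (c1 c2 c3 : ℤ) (hc1 : 0 < c1) (hc2 : 0 < c2) (hc3 : 0 < c3)
    (u : ℕ → ℤ) (h0 : u 0 = 0) (h1 : u 1 = 0) (h2 : u 2 = 1)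
    (hrec : ∀ j : ℕ, 2 < j → u j = c1 * u (j - 1) - c2 * u (j - 2) + c3 * u (j - 3))
    (m : ℕ) (hm : 2 < m) (hum : u m = 0) (hum1 : u (m + 1) = 0)
    (hpos : ∀ j : ℕ, 2 ≤ j → j ≤ m - 1 → 0 < u j) :
    ∃ α β γ : ℂ, α ≠ β ∧ α ≠ γ ∧ β ≠ γ ∧
      (X ^ 3 - C (c1 : ℂ) * X ^ 2 + C (c2 : ℂ) * X - C (c3 : ℂ)) =
        (X - C α) * (X - C β) * (X - C γ) := by
  obtain ⟨k, rfl⟩ : ∃ k, m = k + 1 := ⟨m - 1, by omega⟩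
  set p : ℂ[X] := X ^ 3 - C (c1 : ℂ) * X ^ 2 + C (c2 : ℂ) * X - C (c3 : ℂ) with hp
  have hdvd : p ∣ X ^ (k + 1) - C ((c3 : ℂ) * u k) := by
    have h := dvd_X_pow_succ_sub_impulse (c1 : ℂ) c2 c3 (fun n => (u n : ℂ))
      (by simp [h0]) (by simp [h1]) (by simp [h2])
      (fun n => by exact_mod_cast hrec (n + 3) (by omega)) k
    simpa [hp, hum, show u (k + 2) = 0 from hum1] using h
  have huk : 0 < u k := hpos k (by omega) (by omega)
  have hsep : p.Separable :=
    (separable_X_pow_sub_C _ (by exact_mod_cast k.succ_ne_zero)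
      (by exact_mod_cast (mul_pos hc3 huk).ne')).of_dvd hdvd
  have hdeg : p.natDegree = 3 := by rw [hp]; compute_degree!
  have hmonic : p.Monic := by rw [hp]; monicity!
  have hsplits := IsAlgClosed.splits p
  have hcard : p.roots.card = 3 := hsplits.natDegree_eq_card_roots.symm.trans hdeg
  obtain ⟨α, β, γ, hroots⟩ := Multiset.card_eq_three.mp hcard
  have hnodup := nodup_roots hsep
  have hprod := hsplits.eq_prod_roots_of_monic hmonic
  rw [hroots] at hnodup hprod
  simp only [Multiset.insert_eq_cons, Multiset.nodup_cons, Multiset.mem_cons,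
    Multiset.mem_singleton, not_or] at hnodup
  refine ⟨α, β, γ, hnodup.1.1, hnodup.1.2, hnodup.2.1, ?_⟩
  simpa [mul_assoc] using hprod
end

section
/- Let c₁, c₂, c₃, d, m be positive integers and suppose the polynomial t³ − c₁t² + c₂t − c₃ divides tᵐ − d in ℚ[t]. Then d is a perfect m-th power: there exists a positive integer e with eᵐ = d. -/
open Polynomial

/-- A real cubic of the shape `x³ - ax² + bx - c` with `a, b, c > 0` has a positive root. -/
lemma exists_pos_root_cubic {a b c : ℝ} (ha : 0 < a) (hb : 0 < b) (hc : 0 < c) :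
    ∃ r : ℝ, 0 < r ∧ r ^ 3 - a * r ^ 2 + b * r - c = 0 := by
  have hM : 0 ≤ a + c / b := by positivity
  have hcont : ContinuousOn (fun x : ℝ => x ^ 3 - a * x ^ 2 + b * x - c)
      (Set.Icc 0 (a + c / b)) := by fun_prop
  have hend : 0 ≤ (a + c / b) ^ 3 - a * (a + c / b) ^ 2 + b * (a + c / b) - c := by
    have h : (a + c / b) ^ 3 - a * (a + c / b) ^ 2 + b * (a + c / b) - c
        = (a + c / b) ^ 2 * (c / b) + a * b := by
      field_simp
      ring
    rw [h]
    positivity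
  obtain ⟨r, hr, hr0⟩ := intermediate_value_Icc hM hcont
    (show (0 : ℝ) ∈ Set.Icc _ _ from ⟨by simpa using hc.le, hend⟩)
  refine ⟨r, lt_of_le_of_ne hr.1 ?_, hr0⟩
  rintro rfl
  norm_num at hr0
  exact hc.ne' hr0

/-- If all complex roots of `z³ - az² + bz - c` have modulus equal to its positive real root `r`,
then `b = r * a`. -/
lemma coeff_eq_mul_of_norm_roots_eq {a b c r : ℝ} (hc : 0 < c) (hr : 0 < r)
    (hroot : r ^ 3 - a * r ^ 2 + b * r - c = 0)
    (hnorm : ∀ z : ℂ, z ^ 3 - a * z ^ 2 + b * z - c = 0 → ‖z‖ = r) : b = r * a := by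
  set s : ℝ := r ^ 2 - a * r + b with hs
  have hrs : r * s = c := by rw [hs]; linarith
  have hs0 : 0 < s := pos_of_mul_pos_right (hrs ▸ hc) hr.le
  have hfactor (z : ℂ) :
      z ^ 3 - a * z ^ 2 + b * z - c = (z - r) * (z ^ 2 + (r - a) * z + s) := by
    rw [← hrs, hs]
    push_cast
    ring
  obtain ⟨w, hw⟩ := IsAlgClosed.exists_pow_nat_eq
    (((r - a) ^ 2 - 4 * s : ℂ)) (show 0 < 2 by norm_num)
  have hz (ε : ℂ) (hε : ε ^ 2 = 1) : ‖(a - r + ε * w) / 2‖ = r := by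
    apply hnorm
    rw [hfactor]
    refine mul_eq_zero_of_right _ ?_
    linear_combination (1 / 4) * hw + w ^ 2 / 4 * hε
  have hprod : (a - r + 1 * w) / 2 * ((a - r + (-1) * w) / 2) = (s : ℂ) := by
    linear_combination (-1 / 4) * hw
  have hsr : s = r * r := by
    have h := congrArg norm hprod
    rw [norm_mul, hz 1 (by norm_num), hz (-1) (by norm_num), Complex.norm_of_nonneg hs0.le] at h
    exact h.symm
  linarith

/-- If `c₁, c₂, c₃, d, m` are positive integers and
`t³ − c₁t² + c₂t − c₃` divides `tᵐ − d` in `ℚ[t]`, then `d` is a perfect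
`m`-th power: there is a positive integer `e` with `eᵐ = d`. -/
theorem stmt8 (c1 c2 c3 d : ℤ) (m : ℕ)
    (hc1 : 0 < c1) (hc2 : 0 < c2) (hc3 : 0 < c3) (hd : 0 < d) (hm : 0 < m)
    (hdvd : (X ^ 3 - C (c1 : ℚ) * X ^ 2 + C (c2 : ℚ) * X - C (c3 : ℚ)) ∣
      (X ^ m - C (d : ℚ))) :
    ∃ e : ℤ, 0 < e ∧ e ^ m = d := by
  have hroot_pow (z : ℂ) (hz : z ^ 3 - c1 * z ^ 2 + c2 * z - c3 = 0) : z ^ m = d := by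
    have h := aeval_eq_zero_of_dvd_aeval_eq_zero (x := z) hdvd (by simpa using hz)
    simpa [sub_eq_zero] using h
  obtain ⟨r, hr, hr0⟩ := exists_pos_root_cubic (a := c1) (b := c2) (c := c3)
    (by exact_mod_cast hc1) (by exact_mod_cast hc2) (by exact_mod_cast hc3)
  have hrm : r ^ m = d := by exact_mod_cast hroot_pow r (by exact_mod_cast hr0)
  have hc : (c2 : ℝ) = r * c1 := by
    refine coeff_eq_mul_of_norm_roots_eq (c := c3) (by exact_mod_cast hc3) hr hr0 fun z hz => ?_
    have h := congrArg norm (hroot_pow z (by exact_mod_cast hz))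
    rw [norm_pow, Complex.norm_intCast, abs_of_pos (by exact_mod_cast hd), ← hrm] at h
    exact (pow_left_inj₀ (norm_nonneg z) hr.le hm.ne').1 h
  have hpow : c2 ^ m = c1 ^ m * d := by
    have h : (c2 : ℝ) ^ m = c1 ^ m * d := by rw [hc, mul_pow, hrm, mul_comm]
    exact_mod_cast h
  obtain ⟨e, rfl⟩ := (Int.pow_dvd_pow_iff hm.ne').1 ⟨d, hpow⟩
  refine ⟨e, pos_of_mul_pos_right hc2 hc1.le, ?_⟩
  rw [mul_pow] at hpow
  exact mul_left_cancel₀ (pow_ne_zero m hc1.ne') hpow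
end

section
/- Let c₁, c₂, c₃ be positive integers, let (u_j)_{j≥0} be the integer sequence defined by u₀ = 0, u₁ = 0, u₂ = 1, and u_j = c₁·u_{j−1} − c₂·u_{j−2} + c₃·u_{j−3} for j > 2, and let A be the 3×3 rational matrix with rows (c₁, −c₂, c₃), (1, 0, 0), (0, 1, 0). Suppose m > 2 is an integer with u_m = 0, u_{m+1} = 0, and u_j > 0 for 2 ≤ j ≤ m − 1, and let e be a positive integer with eᵐ = c₃·u_{m−1}. Then the matrix B = (1/e)·A satisfies Bᵐ = I₃, and Bᵏ ≠ I₃ for every integer k with 0 < k < m; that is, B has order exactly m in GL(3, ℚ). -/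
/-- The powers of the companion-type matrix are given by the fundamental solution of the
recurrence. -/
theorem companion_pow_eq (c1 c2 c3 : ℤ) (u : ℕ → ℤ) (h0 : u 0 = 0) (h1 : u 1 = 0)
    (h2 : u 2 = 1) (hrec : ∀ n, u (n + 3) = c1 * u (n + 2) - c2 * u (n + 1) + c3 * u n) (n : ℕ) :
    (!![(c1 : ℚ), -(c2 : ℚ), (c3 : ℚ); 1, 0, 0; 0, 1, 0]) ^ n =
      !![(u (n + 2) : ℚ), u (n + 3) - c1 * u (n + 2),
          u (n + 4) - c1 * u (n + 3) + c2 * u (n + 2);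
        (u (n + 1) : ℚ), u (n + 2) - c1 * u (n + 1),
          u (n + 3) - c1 * u (n + 2) + c2 * u (n + 1);
        (u n : ℚ), u (n + 1) - c1 * u n, u (n + 2) - c1 * u (n + 1) + c2 * u n] := by
  have hrec' : ∀ n, (u (n + 3) : ℚ) = c1 * u (n + 2) - c2 * u (n + 1) + c3 * u n := fun n => by
    exact_mod_cast hrec n
  induction n with
  | zero =>
    have h3 := hrec' 0
    have h4 := hrec' 1
    simp only [Nat.zero_add, Nat.reduceAdd, h0, h1, h2] at h3 h4
    ext i j
    fin_cases i <;> fin_cases j <;> simp [h0, h1, h2, h3, h4]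
  | succ n ih =>
    have h3 := hrec' n
    have h4 := hrec' (n + 1)
    have h5 := hrec' (n + 2)
    simp only [Nat.add_assoc, Nat.reduceAdd] at h3 h4 h5
    rw [pow_succ', ih]
    ext i j
    fin_cases i <;> fin_cases j <;>
      simp [Matrix.mul_apply, Fin.sum_univ_three, Nat.add_assoc, h3, h4, h5] <;> ring

/-- Under the hypotheses of the two-consecutive-zeros lemma, if
`e` is a positive integer with `eᵐ = c₃ u_{m−1}`, then `B = (1/e) A` satisfies
`Bᵐ = I₃` and `Bᵏ ≠ I₃` for `0 < k < m`; i.e., `B` has order exactly `m`. -/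
theorem stmt10 (c1 c2 c3 : ℤ) (hc1 : 0 < c1) (hc2 : 0 < c2) (hc3 : 0 < c3)
    (u : ℕ → ℤ) (h0 : u 0 = 0) (h1 : u 1 = 0) (h2 : u 2 = 1)
    (hrec : ∀ j : ℕ, 2 < j → u j = c1 * u (j - 1) - c2 * u (j - 2) + c3 * u (j - 3))
    (A : Matrix (Fin 3) (Fin 3) ℚ)
    (hA : A = !![(c1 : ℚ), -(c2 : ℚ), (c3 : ℚ); 1, 0, 0; 0, 1, 0])
    (m : ℕ) (hm : 2 < m) (hum : u m = 0) (hum1 : u (m + 1) = 0)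
    (hpos : ∀ j : ℕ, 2 ≤ j → j ≤ m - 1 → 0 < u j)
    (e : ℤ) (he : 0 < e) (hem : e ^ m = c3 * u (m - 1))
    (B : Matrix (Fin 3) (Fin 3) ℚ) (hB : B = (1 / (e : ℚ)) • A) :
    B ^ m = (1 : Matrix (Fin 3) (Fin 3) ℚ) ∧
      ∀ k : ℕ, 0 < k → k < m → B ^ k ≠ (1 : Matrix (Fin 3) (Fin 3) ℚ) := by
  have hrec' : ∀ n, u (n + 3) = c1 * u (n + 2) - c2 * u (n + 1) + c3 * u n := fun n =>
    hrec (n + 3) (by omega)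
  have hpow := companion_pow_eq c1 c2 c3 u h0 h1 h2 hrec'
  rw [← hA] at hpow
  have he0 : (e : ℚ) ≠ 0 := by exact_mod_cast he.ne'
  have hB_pow (k : ℕ) : B ^ k = ((e : ℚ) ^ k)⁻¹ • A ^ k := by
    rw [hB, smul_pow, one_div, inv_pow]
  refine ⟨?_, fun k hk hkm hBk => ?_⟩
  · have hm2 : u (m + 2) = e ^ m := by
      obtain ⟨n, rfl⟩ : ∃ n, m = n + 1 := ⟨m - 1, by omega⟩
      have h := hrec' n
      rw [show n + 2 = n + 1 + 1 from rfl, hum1, hum] at h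
      rw [hem, show n + 1 + 2 = n + 3 from rfl, h]
      simp
    have hm3 : u (m + 3) = c1 * e ^ m := by
      rw [hrec', hm2, hum1, hum]; ring
    have hm4 : u (m + 4) = c1 * (c1 * e ^ m) - c2 * e ^ m := by
      have h := hrec' (m + 1)
      simp only [Nat.add_assoc, Nat.reduceAdd] at h
      rw [h, hm3, hm2, hum1]; ring
    have hAm : A ^ m = (e : ℚ) ^ m • (1 : Matrix (Fin 3) (Fin 3) ℚ) := by
      rw [hpow, hm4, hm3, hm2, hum1, hum]
      ext i j
      fin_cases i <;> fin_cases j <;> simp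
    rw [hB_pow, hAm, smul_smul, inv_mul_cancel₀ (pow_ne_zero m he0), one_smul]
  · have hB_entry (i : Fin 3) (hi : i ≠ 0) : (A ^ k) i 0 = 0 := by
      have h := congrFun (congrFun hBk i) 0
      rw [hB_pow, Matrix.one_apply_ne hi, Matrix.smul_apply, smul_eq_mul] at h
      exact (mul_eq_zero.mp h).resolve_left (inv_ne_zero (pow_ne_zero k he0))
    have hk0 : u k = 0 := by simpa [hpow] using hB_entry 2 (by decide)
    have hk1 : u (k + 1) = 0 := by simpa [hpow] using hB_entry 1 (by decide)
    obtain rfl | hk2 : k = 1 ∨ 2 ≤ k := by omega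
    · simp [h2] at hk1
    · exact (hpos k hk2 (by omega)).ne' hk0
end

section
/- If M is an invertible 3×3 matrix with rational entries that has finite multiplicative order k (i.e., k is the least positive integer with Mᵏ equal to the identity matrix), then k ∈ {1, 2, 3, 4, 6}. -/
open Polynomial in
/-- A divisor of `X ^ k - 1` over `ℚ` is, up to units, the product of the cyclotomic polynomials
dividing it. -/
theorem associated_prod_cyclotomic_of_dvd_X_pow_sub_one {k : ℕ} (hk : 0 < k) {p : ℚ[X]}
    (hp : p ∣ X ^ k - 1) :
    ∃ S ⊆ k.divisors, Associated p (∏ d ∈ S, cyclotomic d ℚ) := by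
  classical
  refine ⟨k.divisors.filter fun d ↦ cyclotomic d ℚ ∣ p, Finset.filter_subset _ _,
    associated_of_dvd_dvd ?_ ?_⟩
  · rw [← prod_cyclotomic_eq_X_pow_sub_one hk,
      ← Finset.prod_filter_mul_prod_filter_not k.divisors (fun d ↦ cyclotomic d ℚ ∣ p)] at hp
    refine IsCoprime.dvd_of_dvd_mul_right (IsCoprime.prod_right fun d hd ↦ ?_) hp
    rw [Finset.mem_filter] at hd
    exact ((cyclotomic.irreducible_rat (Nat.pos_of_mem_divisors hd.1)).coprime_iff_not_dvd.2
      hd.2).symm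
  · refine Finset.prod_dvd_of_coprime (fun a _ b _ hab ↦ cyclotomic.isCoprime_rat hab)
      fun d hd ↦ (Finset.mem_filter.1 hd).2

theorem Nat.mem_of_totient_le_three {n : ℕ} (hn : 0 < n) (h : n.totient ≤ 3) :
    n ∈ ({1, 2, 3, 4, 6} : Finset ℕ) := by
  have key : ∀ d, d ∣ n → d.totient ≤ 3 := fun d hd ↦
    (Nat.le_of_dvd (Nat.totient_pos.2 hn) (Nat.totient_dvd_of_dvd hd)).trans h
  have h12 : ¬ 12 ∣ n := fun hd ↦ absurd (key _ hd) (by decide)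
  have h8 : ¬ 2 ^ 3 ∣ n := fun hd ↦ absurd (key _ hd) (by decide)
  have h9 : ¬ 3 ^ 2 ∣ n := fun hd ↦ absurd (key _ hd) (by decide)
  obtain ⟨a, m, hm, rfl⟩ := Nat.exists_eq_pow_mul_and_not_dvd hn.ne' 2 (by norm_num)
  have hm0 : m ≠ 0 := by rintro rfl; simp at hm
  obtain ⟨b, l, hl, rfl⟩ := Nat.exists_eq_pow_mul_and_not_dvd hm0 3 (by norm_num)
  have hl1 : l = 1 := by
    by_contra hne
    obtain ⟨p, hp, hpl⟩ := Nat.exists_prime_and_dvd hne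
    have hle := key p ((hpl.mul_left _).mul_left _)
    rw [Nat.totient_prime hp] at hle
    have hp4 : p ≤ 4 := by omega
    have h2 := hp.two_le
    interval_cases p
    · exact hm (hpl.mul_left _)
    · exact hl hpl
    · exact absurd hp (by decide)
  subst hl1
  have ha : a < 3 := by
    by_contra! ha
    exact h8 ((pow_dvd_pow 2 ha).mul_right _)
  have hb : b < 2 := by
    by_contra! hb
    exact h9 (((pow_dvd_pow 3 hb).mul_right _).mul_left _)
  interval_cases a <;> interval_cases b <;> simp_all

open Polynomial in
/-- If an invertible `3×3` rational matrix `M` has finite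
multiplicative order `k` (the least positive integer with `Mᵏ = I₃`), then
`k ∈ {1, 2, 3, 4, 6}`. -/
theorem stmt11 (M : Matrix (Fin 3) (Fin 3) ℚ) (hM : IsUnit M) (k : ℕ)
    (hk : 0 < k) (hMk : M ^ k = (1 : Matrix (Fin 3) (Fin 3) ℚ))
    (hmin : ∀ j : ℕ, 0 < j → M ^ j = (1 : Matrix (Fin 3) (Fin 3) ℚ) → k ≤ j) :
    k = 1 ∨ k = 2 ∨ k = 3 ∨ k = 4 ∨ k = 6 := by
  have hdvd : minpoly ℚ M ∣ X ^ k - 1 := minpoly.dvd _ _ (by simp [hMk])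
  obtain ⟨S, hSk, hS⟩ := associated_prod_cyclotomic_of_dvd_X_pow_sub_one hk hdvd
  have hsum : ∑ d ∈ S, d.totient ≤ 3 := by
    have hle := natDegree_le_of_dvd (hS.symm.dvd.trans (Matrix.minpoly_dvd_charpoly M))
      (Matrix.charpoly_monic M).ne_zero
    rw [Matrix.charpoly_natDegree_eq_dim, natDegree_prod _ _ fun d _ ↦ cyclotomic_ne_zero d ℚ]
      at hle
    simpa [natDegree_cyclotomic] using hle
  have hS6 : S ∈ ({1, 2, 3, 4, 6} : Finset ℕ).powerset := by
    rw [Finset.mem_powerset]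
    intro d hd
    exact Nat.mem_of_totient_le_three (Nat.pos_of_mem_divisors (hSk hd))
      ((Finset.single_le_sum (fun _ _ ↦ Nat.zero_le _) hd).trans hsum)
  have hlcm : ∀ T ∈ ({1, 2, 3, 4, 6} : Finset ℕ).powerset, ∑ d ∈ T, d.totient ≤ 3 →
      T.lcm id ∈ ({1, 2, 3, 4, 6} : Finset ℕ) := by decide
  have hLk : S.lcm id ∣ k := Finset.lcm_dvd fun d hd ↦ Nat.dvd_of_mem_divisors (hSk hd)
  have hL : 0 < S.lcm id := Nat.pos_of_dvd_of_pos hLk hk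
  have hML : M ^ S.lcm id = 1 := by
    have hdvd' : minpoly ℚ M ∣ X ^ S.lcm id - 1 := by
      rw [← prod_cyclotomic_eq_X_pow_sub_one hL]
      refine hS.dvd.trans (Finset.prod_dvd_prod_of_subset _ _ _ fun d hd ↦ ?_)
      exact Nat.mem_divisors.2 ⟨Finset.dvd_lcm (f := id) hd, hL.ne'⟩
    have hzero := (minpoly.dvd_iff).1 hdvd'
    simpa [sub_eq_zero] using hzero
  have hkL : k = S.lcm id := (hmin _ hL hML).antisymm (Nat.le_of_dvd hk hLk)
  have hmem := hlcm S hS6 hsum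
  rw [← hkL] at hmem
  simpa using hmem
end
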